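/- Let δ_1 be the point mass at 1. Then the uniform distribution Unif(0, 3/2) on the interval [0, 3/2] is the unique minimizer of ν ↦ W_2(ν, δ_1) over ν ∈ F_{m,2}; that is, proj_{F_{m,2}} δ_1 = Unif(0, 3/2). -/

import Mathlib

open MeasureTheory Set Filter

noncomputable def quantile (μ : MeasureTheory.Measure ℝ) (u : ℝ) : ℝ :=
  sInf {x : ℝ | u ≤ (μ (Set.Iic x)).toReal}

def HasFiniteMomentP (p : ℝ) (μ : MeasureTheory.Measure ℝ) : Prop :=
  MeasureTheory.IsProbabilityMeasure μ ∧
    MeasureTheory.Integrable (fun x => |x| ^ p) μ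

noncomputable def Wdist (p : ℝ) (μ ν : MeasureTheory.Measure ℝ) : ℝ :=
  (∫ u in Set.Ioo (0:ℝ) 1, |quantile μ u - quantile ν u| ^ p) ^ (1 / p)

def DisplacementConvex (F : Set (MeasureTheory.Measure ℝ)) : Prop :=
  ∀ μ ∈ F, ∀ ν ∈ F, ∀ t ∈ Set.Icc (0:ℝ) 1, ∃ σ ∈ F,
    ∀ u ∈ Set.Ioo (0:ℝ) 1,
      quantile σ u = (1 - t) * quantile μ u + t * quantile ν u

def WClosed (p : ℝ) (F : Set (MeasureTheory.Measure ℝ)) : Prop :=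
  ∀ (μs : ℕ → MeasureTheory.Measure ℝ) (μ : MeasureTheory.Measure ℝ),
    (∀ n, μs n ∈ F) → HasFiniteMomentP p μ →
    Filter.Tendsto (fun n => Wdist p (μs n) μ) Filter.atTop (nhds 0) → μ ∈ F

/-- The model `F_{m,p}`: probability measures on `[0,∞)` with finite `p`-th moment whose
quantile function is convex, non-decreasing, and tends to `0` as `u ↓ 0`. -/
def Fmp (p : ℝ) : Set (MeasureTheory.Measure ℝ) :=
  {μ | HasFiniteMomentP p μ ∧ μ (Set.Iio (0:ℝ)) = 0 ∧
    ConvexOn ℝ (Set.Ioo (0:ℝ) 1) (quantile μ) ∧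
    MonotoneOn (quantile μ) (Set.Ioo (0:ℝ) 1) ∧
    Filter.Tendsto (quantile μ) (nhdsWithin 0 (Set.Ioi 0)) (nhds 0)}

theorem quantile_le_iff (μ : Measure ℝ) [IsProbabilityMeasure μ] {u : ℝ} (hu : u ∈ Ioo (0:ℝ) 1)
    (x : ℝ) : quantile μ u ≤ x ↔ u ≤ (μ (Iic x)).toReal := by
  have hcdf : ∀ y, (μ (Iic y)).toReal = ProbabilityTheory.cdf μ y := fun y =>
    (ProbabilityTheory.cdf_eq_real μ y).symm
  simp only [quantile, hcdf]
  have hmono := ProbabilityTheory.monotone_cdf μ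
  have hne : {y : ℝ | u ≤ ProbabilityTheory.cdf μ y}.Nonempty :=
    ((ProbabilityTheory.tendsto_cdf_atTop μ).eventually_const_le hu.2).exists
  have hbdd : BddBelow {y : ℝ | u ≤ ProbabilityTheory.cdf μ y} := by
    obtain ⟨b, hb⟩ := ((ProbabilityTheory.tendsto_cdf_atBot μ).eventually_lt_const hu.1).exists
    refine ⟨b, fun y hy => le_of_not_gt fun hyb => ?_⟩
    exact absurd (hmono hyb.le) (not_le.2 (hb.trans_le hy))
  refine ⟨fun h => ?_, fun h => csInf_le hbdd h⟩
  have hright : Tendsto (ProbabilityTheory.cdf μ) (nhdsWithin x (Ioi x))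
      (nhds (ProbabilityTheory.cdf μ x)) :=
    ((ProbabilityTheory.cdf μ).right_continuous x).mono_left (nhdsWithin_mono x Ioi_subset_Ici_self)
  refine ge_of_tendsto hright ?_
  filter_upwards [self_mem_nhdsWithin] with y hy
  obtain ⟨z, hz, hzy⟩ := exists_lt_of_csInf_lt hne (h.trans_lt hy)
  exact le_trans hz (hmono hzy.le)

theorem monotoneOn_quantile (μ : Measure ℝ) [IsProbabilityMeasure μ] :
    MonotoneOn (quantile μ) (Ioo 0 1) := fun _ hu _ hv huv =>
  (quantile_le_iff μ hu _).2 (huv.trans ((quantile_le_iff μ hv _).1 le_rfl))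

theorem aemeasurable_quantile (μ : Measure ℝ) [IsProbabilityMeasure μ] :
    AEMeasurable (quantile μ) (volume.restrict (Ioo 0 1)) :=
  aemeasurable_restrict_of_monotoneOn measurableSet_Ioo (monotoneOn_quantile μ)

theorem map_quantile (μ : Measure ℝ) [IsProbabilityMeasure μ] :
    (volume.restrict (Ioo (0:ℝ) 1)).map (quantile μ) = μ := by
  have hfin : IsProbabilityMeasure (volume.restrict (Ioo (0:ℝ) 1)) := ⟨by simp⟩
  have := Measure.isProbabilityMeasure_map (aemeasurable_quantile μ)
  refine Measure.ext_of_Iic _ _ fun x => ?_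
  rw [Measure.map_apply_of_aemeasurable (aemeasurable_quantile μ) measurableSet_Iic,
    Measure.restrict_apply' measurableSet_Ioo]
  have hset : quantile μ ⁻¹' Iic x ∩ Ioo 0 1 = Iic (μ (Iic x)).toReal ∩ Ioo 0 1 := by
    ext u
    simp only [mem_inter_iff, mem_preimage, mem_Iic, and_congr_left_iff]
    exact fun hu => quantile_le_iff μ hu x
  have hle : (μ (Iic x)).toReal ≤ 1 := measureReal_le_one
  have hIoc : Iic (μ (Iic x)).toReal ∩ Ioc 0 1 = Ioc 0 (μ (Iic x)).toReal := by
    ext u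
    simp only [mem_inter_iff, mem_Iic, mem_Ioc]
    exact ⟨fun h => ⟨h.2.1, h.1⟩, fun h => ⟨h.2, h.1, h.2.trans hle⟩⟩
  rw [hset, measure_congr ((ae_eq_refl (Iic _)).inter Ioo_ae_eq_Ioc), hIoc, Real.volume_Ioc, sub_zero, ENNReal.ofReal_toReal (measure_ne_top μ _)]

theorem memLp_two_quantile {μ : Measure ℝ} (hμ : HasFiniteMomentP 2 μ) :
    MemLp (quantile μ) 2 (volume.restrict (Ioo 0 1)) := by
  have := hμ.1
  have hint := hμ.2
  rw [← map_quantile μ] at hint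
  rw [memLp_two_iff_integrable_sq (aemeasurable_quantile μ).aestronglyMeasurable]
  refine (hint.comp_aemeasurable (aemeasurable_quantile μ)).congr ?_
  exact Eventually.of_forall fun u => by simp

theorem quantile_dirac (a : ℝ) {u : ℝ} (hu : u ∈ Ioo (0:ℝ) 1) :
    quantile (Measure.dirac a) u = a := by
  refine eq_of_forall_ge_iff fun x => ?_
  rw [quantile_le_iff _ hu, Measure.dirac_apply' _ measurableSet_Iic]
  by_cases h : a ≤ x
  · simp [h, hu.2.le]
  · simp [h, hu.1]

theorem Wdist_two_dirac_one (μ : Measure ℝ) :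
    Wdist 2 μ (Measure.dirac 1) = (∫ u in Ioo (0:ℝ) 1, (quantile μ u - 1) ^ 2) ^ ((1:ℝ) / 2) := by
  unfold Wdist
  congr 1
  refine setIntegral_congr_fun measurableSet_Ioo fun u hu => ?_
  simp [quantile_dirac 1 hu]

theorem Wdist_two_dirac_one_le_iff (μ ν : Measure ℝ) :
    Wdist 2 μ (Measure.dirac 1) ≤ Wdist 2 ν (Measure.dirac 1) ↔
      ∫ u in Ioo (0:ℝ) 1, (quantile μ u - 1) ^ 2 ≤ ∫ u in Ioo (0:ℝ) 1, (quantile ν u - 1) ^ 2 := by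
  rw [Wdist_two_dirac_one, Wdist_two_dirac_one]
  exact Real.rpow_le_rpow_iff (integral_nonneg fun _ => sq_nonneg _)
    (integral_nonneg fun _ => sq_nonneg _) (by norm_num)

/-- A convex function on `(0, 1)` vanishing at `0+` is star-shaped. -/
theorem ConvexOn.mul_le_mul_of_tendsto_zero {f : ℝ → ℝ} (hf : ConvexOn ℝ (Ioo (0:ℝ) 1) f)
    (h0 : Tendsto f (nhdsWithin 0 (Ioi 0)) (nhds 0)) {u v : ℝ} (hu : 0 < u) (huv : u ≤ v)
    (hv : v < 1) : v * f u ≤ u * f v := by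
  rcases huv.eq_or_lt with rfl | huv
  · exact le_rfl
  have hid : Tendsto (fun ε : ℝ => ε) (nhdsWithin 0 (Ioi 0)) (nhds 0) := nhdsWithin_le_nhds
  have hl : Tendsto (fun ε => (v - ε) * f u) (nhdsWithin 0 (Ioi 0)) (nhds ((v - 0) * f u)) :=
    (hid.const_sub v).mul_const _
  have hr : Tendsto (fun ε => (v - u) * f ε + (u - ε) * f v) (nhdsWithin 0 (Ioi 0))
      (nhds ((v - u) * 0 + (u - 0) * f v)) :=
    (h0.const_mul _).add ((hid.const_sub u).mul_const _)
  have hle : ∀ᶠ ε in nhdsWithin (0:ℝ) (Ioi 0),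
      (v - ε) * f u ≤ (v - u) * f ε + (u - ε) * f v := by
    filter_upwards [Ioo_mem_nhdsGT hu] with ε hε
    have hpos : 0 < v - ε := by linarith [hε.2]
    have hc := hf.2 (⟨hε.1, by linarith [hε.2]⟩ : ε ∈ Ioo 0 1) (⟨by linarith, hv⟩ : v ∈ Ioo 0 1)
      (div_nonneg (by linarith) hpos.le : 0 ≤ (v - u) / (v - ε))
      (div_nonneg (by linarith [hε.2]) hpos.le : 0 ≤ (u - ε) / (v - ε))
      (by field_simp; ring)
    simp only [smul_eq_mul] at hc
    have heq : (v - u) / (v - ε) * ε + (u - ε) / (v - ε) * v = u := by field_simp; ring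
    rw [heq] at hc
    calc (v - ε) * f u
        ≤ (v - ε) * ((v - u) / (v - ε) * f ε + (u - ε) / (v - ε) * f v) :=
          mul_le_mul_of_nonneg_left hc hpos.le
      _ = (v - u) * f ε + (u - ε) * f v := by field_simp
  simpa using le_of_tendsto_of_tendsto hl hr hle

theorem setIntegral_sq_sub_one_ge {f : ℝ → ℝ} (hf : ConvexOn ℝ (Ioo (0:ℝ) 1) f)
    (h0 : Tendsto f (nhdsWithin 0 (Ioi 0)) (nhds 0))
    (hLp : MemLp f 2 (volume.restrict (Ioo 0 1))) :
    (∫ u in Ioo (0:ℝ) 1, (f u - 3 / 2 * u) ^ 2) + ∫ u in Ioo (0:ℝ) 1, (3 / 2 * u - 1) ^ 2 ≤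
      ∫ u in Ioo (0:ℝ) 1, (f u - 1) ^ 2 := by
  have hcont : ∀ g : ℝ → ℝ, Continuous g → IntegrableOn g (Ioo 0 1) := fun g hg =>
    (hg.integrableOn_Icc (a := 0) (b := 1)).mono_set Ioo_subset_Icc_self
  have hlin : MemLp (fun u : ℝ => 3 / 2 * u) 2 (volume.restrict (Ioo (0:ℝ) 1)) :=
    (memLp_two_iff_integrable_sq (by fun_prop)).2 (hcont _ (by fun_prop))
  have h1 : Integrable (fun u => (f u - 3 / 2 * u) ^ 2) (volume.restrict (Ioo (0:ℝ) 1)) :=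
    (hLp.sub hlin).integrable_sq
  have h2 : Integrable (fun u => (f u - 1) ^ 2) (volume.restrict (Ioo (0:ℝ) 1)) :=
    (hLp.sub (memLp_const 1)).integrable_sq
  have h3 : Integrable (fun u : ℝ => (3 / 2 * u - 1) ^ 2) (volume.restrict (Ioo (0:ℝ) 1)) :=
    hcont _ (by fun_prop)
  have h4 : Integrable (fun u : ℝ => 2 * (f (2 / 3) - 1) * (3 / 2 * u * (3 / 2 * u - 1)))
      (volume.restrict (Ioo (0:ℝ) 1)) := hcont _ (by fun_prop)
  have h4z : ∫ u in Ioo (0:ℝ) 1, 2 * (f (2 / 3) - 1) * (3 / 2 * u * (3 / 2 * u - 1)) = 0 := by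
    rw [integral_const_mul, ← integral_Ioc_eq_integral_Ioo,
      ← intervalIntegral.integral_of_le zero_le_one]
    have hfun : (fun u : ℝ => 3 / 2 * u * (3 / 2 * u - 1)) =
        fun u => 9 / 4 * u ^ 2 - 3 / 2 * u := by ext u; ring
    rw [hfun, intervalIntegral.integral_sub (Continuous.intervalIntegrable (by fun_prop) _ _)
      (Continuous.intervalIntegrable (by fun_prop) _ _), intervalIntegral.integral_const_mul,
      intervalIntegral.integral_const_mul, integral_pow, integral_id]
    norm_num
  have hpt : ∀ u ∈ Ioo (0:ℝ) 1, (f u - 3 / 2 * u) ^ 2 + (3 / 2 * u - 1) ^ 2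
      + 2 * (f (2 / 3) - 1) * (3 / 2 * u * (3 / 2 * u - 1)) ≤ (f u - 1) ^ 2 := by
    intro u hu
    have hprod : 0 ≤ (f u - f (2 / 3) * (3 / 2 * u)) * (3 / 2 * u - 1) := by
      rcases le_total u (2 / 3) with h | h
      · have := hf.mul_le_mul_of_tendsto_zero h0 hu.1 h (by norm_num)
        exact mul_nonneg_of_nonpos_of_nonpos (by linarith) (by linarith)
      · have := hf.mul_le_mul_of_tendsto_zero h0 (by norm_num) h hu.2
        exact mul_nonneg (by linarith) (by linarith)
    linarith
  have hmono := setIntegral_mono_on ((h1.add h3).add h4) h2 measurableSet_Ioo hpt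
  rwa [integral_add' (h1.add h3) h4, h4z, add_zero, integral_add' h1 h3] at hmono

theorem uniform_apply_Iic {x : ℝ} (hx : x ≤ 3 / 2) :
    ((ENNReal.ofReal (3/2))⁻¹ • volume.restrict (Icc (0:ℝ) (3/2))) (Iic x) =
      ENNReal.ofReal (2 / 3 * x) := by
  have hset : Iic x ∩ Icc 0 (3 / 2) = Icc 0 x := by
    ext u
    simp only [mem_inter_iff, mem_Iic, mem_Icc]
    exact ⟨fun h => ⟨h.2.1, h.1⟩, fun h => ⟨h.2, h.1, h.2.trans hx⟩⟩
  rw [Measure.smul_apply, Measure.restrict_apply measurableSet_Iic, hset, Real.volume_Icc,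
    sub_zero, smul_eq_mul, ← ENNReal.ofReal_inv_of_pos (by norm_num),
    ← ENNReal.ofReal_mul (by norm_num)]
  norm_num

theorem isProbabilityMeasure_uniform : IsProbabilityMeasure
    ((ENNReal.ofReal (3/2))⁻¹ • volume.restrict (Icc (0:ℝ) (3/2))) := by
  refine ⟨?_⟩
  rw [Measure.smul_apply, Measure.restrict_apply_univ, Real.volume_Icc, sub_zero, smul_eq_mul]
  exact ENNReal.inv_mul_cancel (by simp) (by simp)

theorem quantile_uniform {u : ℝ} (hu : u ∈ Ioo (0:ℝ) 1) :
    quantile ((ENNReal.ofReal (3/2))⁻¹ • volume.restrict (Icc (0:ℝ) (3/2))) u = 3 / 2 * u := by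
  have := isProbabilityMeasure_uniform
  refine eq_of_forall_ge_iff fun x => ?_
  rw [quantile_le_iff _ hu]
  rcases le_total x (3 / 2) with hx | hx
  · rw [uniform_apply_Iic hx]
    rcases le_total x 0 with h | h
    · rw [ENNReal.ofReal_of_nonpos (by linarith), ENNReal.toReal_zero]
      constructor <;> intro _ <;> linarith [hu.1]
    · rw [ENNReal.toReal_ofReal (by linarith)]
      constructor <;> intro _ <;> linarith
  · refine iff_of_true ?_ (by linarith [hu.2])
    have hmono := measureReal_mono (Iic_subset_Iic.2 hx)
      (μ := (ENNReal.ofReal (3/2))⁻¹ • volume.restrict (Icc (0:ℝ) (3/2)))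
    simp only [Measure.real] at hmono
    rw [uniform_apply_Iic le_rfl, ENNReal.toReal_ofReal (by norm_num)] at hmono
    linarith [hu.2]

theorem uniform_mem_Fmp :
    (ENNReal.ofReal (3/2))⁻¹ • volume.restrict (Icc (0:ℝ) (3/2)) ∈ Fmp 2 := by
  have hprob := isProbabilityMeasure_uniform
  refine ⟨⟨hprob, ?_⟩, ?_, ?_, monotoneOn_quantile _, ?_⟩
  · refine Integrable.smul_measure ?_ (by simp)
    simp only [Real.rpow_two]
    exact Continuous.integrableOn_Icc (by fun_prop)
  · refine measure_mono_null Iio_subset_Iic_self ?_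
    rw [uniform_apply_Iic (by norm_num)]
    simp
  · have hlin : ConvexOn ℝ (Ioo (0:ℝ) 1) (fun u : ℝ => 3 / 2 * u) :=
      (convexOn_id (convex_Ioo 0 1)).smul (c := (3 / 2 : ℝ)) (by norm_num)
    exact hlin.congr fun u hu => (quantile_uniform hu).symm
  · have hlin : Tendsto (fun u : ℝ => 3 / 2 * u) (nhdsWithin 0 (Ioi 0)) (nhds 0) := by
      have : Continuous fun u : ℝ => 3 / 2 * u := by fun_prop
      simpa using (this.tendsto 0).mono_left (nhdsWithin_le_nhds (s := Ioi 0))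
    refine hlin.congr' ?_
    filter_upwards [Ioo_mem_nhdsGT zero_lt_one] with u hu
    exact (quantile_uniform hu).symm

/-- Example 3.6. The uniform distribution `Unif(0, 3/2)` is the unique
minimizer of `ν ↦ W_2(ν, δ_1)` over `F_{m,2}`; that is,
`proj_{F_{m,2}} δ_1 = Unif(0, 3/2)`. -/
theorem wasserstein_projection_of_dirac_one :
    letI unif : MeasureTheory.Measure ℝ :=
      (ENNReal.ofReal (3/2))⁻¹ • MeasureTheory.volume.restrict (Set.Icc (0:ℝ) (3/2))
    unif ∈ Fmp 2 ∧
      (∀ ν ∈ Fmp 2, Wdist 2 unif (MeasureTheory.Measure.dirac 1) ≤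
        Wdist 2 ν (MeasureTheory.Measure.dirac 1)) ∧
      (∀ ν ∈ Fmp 2,
        (∀ ρ ∈ Fmp 2, Wdist 2 ν (MeasureTheory.Measure.dirac 1) ≤
          Wdist 2 ρ (MeasureTheory.Measure.dirac 1)) → ν = unif) := by
  have hprob := isProbabilityMeasure_uniform
  have hunif : ∫ u in Ioo (0:ℝ) 1,
      (quantile ((ENNReal.ofReal (3/2))⁻¹ • volume.restrict (Icc (0:ℝ) (3/2))) u - 1) ^ 2 =
      ∫ u in Ioo (0:ℝ) 1, (3 / 2 * u - 1) ^ 2 :=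
    setIntegral_congr_fun measurableSet_Ioo fun u hu => by simp only [quantile_uniform hu]
  have hge : ∀ ν ∈ Fmp 2, _ := fun ν (hν : ν ∈ Fmp 2) =>
    setIntegral_sq_sub_one_ge hν.2.2.1 hν.2.2.2.2 (memLp_two_quantile hν.1)
  refine ⟨uniform_mem_Fmp, fun ν hν => ?_, fun ν hν hmin => ?_⟩
  · rw [Wdist_two_dirac_one_le_iff, hunif]
    have hnn : 0 ≤ ∫ u in Ioo (0:ℝ) 1, (quantile ν u - 3 / 2 * u) ^ 2 :=
      integral_nonneg fun _ => sq_nonneg _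
    linarith [hge ν hν]
  · have hle := hmin _ uniform_mem_Fmp
    rw [Wdist_two_dirac_one_le_iff, hunif] at hle
    have hzero : ∫ u in Ioo (0:ℝ) 1, (quantile ν u - 3 / 2 * u) ^ 2 = 0 :=
      le_antisymm (by linarith [hge ν hν]) (integral_nonneg fun _ => sq_nonneg _)
    have hνprob := hν.1.1
    have hlin : MemLp (fun u : ℝ => 3 / 2 * u) 2 (volume.restrict (Ioo (0:ℝ) 1)) :=
      (memLp_congr_ae ((ae_restrict_mem measurableSet_Ioo).mono fun u hu =>
        quantile_uniform hu)).1 (memLp_two_quantile uniform_mem_Fmp.1)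
    have hint : Integrable (fun u => (quantile ν u - 3 / 2 * u) ^ 2)
        (volume.restrict (Ioo (0:ℝ) 1)) :=
      ((memLp_two_quantile hν.1).sub hlin).integrable_sq
    have hae := (integral_eq_zero_iff_of_nonneg (fun _ => sq_nonneg _) hint).1 hzero
    rw [← map_quantile ν, ← map_quantile (_ • volume.restrict (Icc (0:ℝ) (3/2)))]
    refine Measure.map_congr ?_
    filter_upwards [hae, ae_restrict_mem measurableSet_Ioo] with u hu hmem
    rw [quantile_uniform hmem]
    exact sub_eq_zero.1 (pow_eq_zero_iff two_ne_zero |>.1 hu)
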